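/- arXiv:math/0510456 — 6 statements merged into one kernel-verified Lean document; each statement's English description precedes it below -/
import Mathlib

section
/- Let n, N, d ∈ ℕ and ε ∈ ℝ with ε > 0 be given. Then there exists r = r(n,N,d,ε) ∈ ℕ such that for every real polynomial f in n variables of degree at most d, with all coefficients bounded in absolute value by N, and nonnegative on [−1,1]^n, the polynomial f + ε·Θ_{r'} is a sum of squares of polynomials for every r' ≥ r. -/
open MvPolynomial

/-- `Θ_r = 1 + ∑_{j=1}^n X_j^{2r}`. -/
noncomputable def Theta (n r : ℕ) : MvPolynomial (Fin n) ℝ :=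
  1 + ∑ j : Fin n, X j ^ (2 * r)

open Filter Topology

section Separation

/-- If `e` is an order unit for the subspace `V` and `g` is not in the cone `s`, then some
functional normalized at `e` is nonnegative on `s ∩ V` and nonpositive at `g`. -/
theorem PointedCone.exists_linearMap_separating {E : Type*} [AddCommGroup E] [Module ℝ E]
    (s : PointedCone ℝ E) (V : Submodule ℝ E) {e g : E} (heV : e ∈ V) (hgV : g ∈ V)
    (hes : e ∈ s) (hes' : -e ∉ s) (hgs : g ∉ s) (hV : ∀ v ∈ V, ∃ c : ℝ, c • e + v ∈ s) :
    ∃ L : E →ₗ[ℝ] ℝ, L e = 1 ∧ L g ≤ 0 ∧ ∀ v ∈ V, v ∈ s → 0 ≤ L v := by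
  have hsmul : ∀ (c : ℝ), 0 ≤ c → ∀ x ∈ s, c • x ∈ s := fun c hc x hx =>
    PointedCone.smul_mem s hc hx
  let t : PointedCone ℝ V :=
    { carrier := {v | ∃ τ : ℝ, 0 ≤ τ ∧ (v : E) + τ • g ∈ s}
      add_mem' := by
        rintro x y ⟨a, ha, hx⟩ ⟨b, hb, hy⟩
        refine ⟨a + b, add_nonneg ha hb, ?_⟩
        convert s.add_mem hx hy using 1
        push_cast
        module
      zero_mem' := ⟨0, le_rfl, by simp⟩
      smul_mem' := by
        rintro ⟨c, hc⟩ x ⟨a, ha, hx⟩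
        refine ⟨c * a, mul_nonneg hc ha, ?_⟩
        convert hsmul c hc _ hx using 1
        rw [smul_add, mul_smul]
        rfl }
  have he0 : (⟨e, heV⟩ : V) ≠ 0 := by
    intro h
    have : e = 0 := congrArg Subtype.val h
    exact hes' (by simp [this])
  obtain ⟨L, hL, hLt⟩ := riesz_extension t (LinearPMap.mkSpanSingleton (⟨e, heV⟩ : V) (1 : ℝ) he0)
    (by
      rintro ⟨x, hx⟩ hxt
      obtain ⟨c, rfl⟩ := Submodule.mem_span_singleton.1 hx
      obtain ⟨τ, hτ, hs⟩ := hxt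
      rw [LinearPMap.mkSpanSingleton'_apply, smul_eq_mul, mul_one]
      by_contra! hc
      replace hc : c < 0 := hc
      have hs : c • e + τ • g ∈ s := hs
      rcases hτ.eq_or_lt with rfl | hτ
      · apply hes'
        convert hsmul (-c)⁻¹ (by simpa using hc.le) _ hs using 1
        rw [zero_smul, add_zero, smul_smul, inv_neg, neg_mul, inv_mul_cancel₀ hc.ne, neg_smul,
          one_smul]
      · apply hgs
        convert hsmul τ⁻¹ (by positivity) _ (s.add_mem hs (hsmul (-c) (by linarith) _ hes)) using 1
        rw [add_right_comm, ← add_smul, add_neg_cancel, zero_smul, zero_add, smul_smul,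
          inv_mul_cancel₀ hτ.ne', one_smul])
    (by
      rintro ⟨v, hv⟩
      obtain ⟨c, hc⟩ := hV v hv
      exact ⟨⟨c • ⟨e, heV⟩, Submodule.mem_span_singleton.2 ⟨c, rfl⟩⟩, 0, le_rfl, by simpa using hc⟩)
  obtain ⟨L', hL'⟩ := LinearMap.exists_extend L
  have hval : ∀ v (hv : v ∈ V), L' v = L ⟨v, hv⟩ := fun v hv => by rw [← hL']; rfl
  refine ⟨L', ?_, ?_, fun v hv hvs => ?_⟩
  · rw [hval e heV]
    exact (hL ⟨⟨e, heV⟩, Submodule.mem_span_singleton_self _⟩).trans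
      (LinearPMap.mkSpanSingleton_apply ℝ ℝ (σ := RingHom.id ℝ) he0 1)
  · have : 0 ≤ L (-⟨g, hgV⟩) := hLt _ ⟨1, zero_le_one, by simp⟩
    rw [map_neg] at this
    rw [hval g hgV]
    linarith
  · rw [hval v hv]
    exact hLt _ ⟨0, le_rfl, by simpa using hvs⟩

end Separation

section SumSq

variable {σ : Type*}

/-- The cone of sums of squares of real polynomials. -/
def sumSqCone (σ : Type*) : PointedCone ℝ (MvPolynomial σ ℝ) where
  carrier := {p | IsSumSq p}
  add_mem' := IsSumSq.add
  zero_mem' := IsSumSq.zero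
  smul_mem' := by
    rintro ⟨c, hc⟩ p hp
    have : IsSumSq (C (√c) * C (√c) * p) := (IsSumSq.mul_self _).mul hp
    rw [← C_mul, Real.mul_self_sqrt hc, ← smul_eq_C_mul] at this
    exact this

theorem mem_sumSqCone {p : MvPolynomial σ ℝ} : p ∈ sumSqCone σ ↔ IsSumSq p := Iff.rfl

theorem smul_mem_sumSqCone {c : ℝ} (hc : 0 ≤ c) {p : MvPolynomial σ ℝ} (hp : p ∈ sumSqCone σ) :
    c • p ∈ sumSqCone σ :=
  PointedCone.smul_mem _ hc hp

theorem sq_mem_sumSqCone (p : MvPolynomial σ ℝ) : p ^ 2 ∈ sumSqCone σ := by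
  rw [sq]; exact IsSumSq.mul_self p

theorem isSumSq_one_add_pow_sub_pow {R : Type*} [CommRing R] (x : R) {k r : ℕ} (h : k ≤ r) :
    IsSumSq (1 + x ^ (2 * r) - x ^ (2 * k)) := by
  obtain ⟨m, rfl⟩ := Nat.exists_eq_add_of_le h
  have hsq : ∀ a, IsSumSq (x ^ (2 * a)) := fun a => by
    rw [two_mul, pow_add]; exact IsSumSq.mul_self _
  have hgeom : ∀ a, (∑ j ∈ Finset.range a, x ^ (2 * j)) * (1 - x ^ 2) = 1 - x ^ (2 * a) :=
    fun a => by simpa only [pow_mul] using geom_sum_mul_neg (x ^ 2) a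
  have key : 1 + x ^ (2 * (k + m)) - x ^ (2 * k) =
      (∑ j ∈ Finset.range k, x ^ (2 * j)) * (∑ j ∈ Finset.range m, x ^ (2 * j)) *
        ((1 - x ^ 2) * (1 - x ^ 2)) + x ^ (2 * m) := by
    calc _ = (1 - x ^ (2 * k)) * (1 - x ^ (2 * m)) + x ^ (2 * m) := by ring
      _ = _ := by rw [← hgeom, ← hgeom]; ring
  rw [key]
  exact (((IsSumSq.sum fun j _ => hsq j).mul (IsSumSq.sum fun j _ => hsq j)).mul
    (IsSumSq.mul_self _)).add (hsq m)

end SumSq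

section OrderUnit

variable {n : ℕ}

theorem Theta_mem_sumSqCone (r : ℕ) : Theta n r ∈ sumSqCone (Fin n) := by
  refine IsSumSq.add IsSumSq.one (IsSumSq.sum fun j _ => ?_)
  rw [two_mul, pow_add]
  exact IsSumSq.mul_self _

theorem eval_nonneg_of_isSumSq {σ : Type*} {p : MvPolynomial σ ℝ} (hp : IsSumSq p) (x : σ → ℝ) :
    0 ≤ eval x p := by
  induction hp with
  | zero => simp
  | sq_add a _ ih => rw [map_add, map_mul]; exact add_nonneg (mul_self_nonneg _) ih

theorem neg_Theta_notMem_sumSqCone (r : ℕ) : -Theta n r ∉ sumSqCone (Fin n) := by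
  intro h
  have h1 := eval_nonneg_of_isSumSq (mem_sumSqCone.1 h) (fun _ => 1)
  simp [Theta] at h1
  have : (0 : ℝ) ≤ n := n.cast_nonneg
  linarith

theorem Theta_sub_one_mem (r : ℕ) : Theta n r - 1 ∈ sumSqCone (Fin n) := by
  rw [Theta, add_sub_cancel_left]
  refine IsSumSq.sum fun j _ => ?_
  rw [two_mul, pow_add]
  exact IsSumSq.mul_self _

theorem Theta_sub_X_pow_mem (i : Fin n) {k r : ℕ} (h : k ≤ r) :
    Theta n r - X i ^ (2 * k) ∈ sumSqCone (Fin n) := by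
  rw [Theta, ← Finset.add_sum_erase _ _ (Finset.mem_univ i)]
  have := (isSumSq_one_add_pow_sub_pow (X i : MvPolynomial (Fin n) ℝ) h).add
    (IsSumSq.sum (I := Finset.univ.erase i)
      (s := fun j : Fin n => (X j : MvPolynomial (Fin n) ℝ) ^ (2 * r)) fun j _ => by
        rw [two_mul, pow_add]
        exact IsSumSq.mul_self _)
  rwa [show ∀ a b c d : MvPolynomial (Fin n) ℝ, a + b - c + d = a + (b + d) - c by
    intros; ring] at this

/-- `-c Θ_r ≤ p ≤ c Θ_r` modulo sums of squares. -/
def ThetaBdd (r : ℕ) (c : ℝ) (p : MvPolynomial (Fin n) ℝ) : Prop :=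
  c • Theta n r + p ∈ sumSqCone (Fin n) ∧ c • Theta n r - p ∈ sumSqCone (Fin n)

theorem ThetaBdd.add {r : ℕ} {c c' : ℝ} {p q : MvPolynomial (Fin n) ℝ} (hp : ThetaBdd r c p)
    (hq : ThetaBdd r c' q) : ThetaBdd r (c + c') (p + q) := by
  constructor
  · convert add_mem hp.1 hq.1 using 1; module
  · convert add_mem hp.2 hq.2 using 1; module

theorem ThetaBdd.smul {r : ℕ} {c : ℝ} {p : MvPolynomial (Fin n) ℝ} (hp : ThetaBdd r c p) (a : ℝ) :
    ThetaBdd r (|a| * c) (a • p) := by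
  rcases le_total 0 a with ha | ha
  · rw [abs_of_nonneg ha]
    constructor
    · convert smul_mem_sumSqCone ha hp.1 using 1; module
    · convert smul_mem_sumSqCone ha hp.2 using 1; module
  · rw [abs_of_nonpos ha]
    constructor
    · convert smul_mem_sumSqCone (neg_nonneg.2 ha) hp.2 using 1; module
    · convert smul_mem_sumSqCone (neg_nonneg.2 ha) hp.1 using 1; module

theorem ThetaBdd.of_sq {r : ℕ} {c : ℝ} {p : MvPolynomial (Fin n) ℝ} (hp : ThetaBdd r c (p ^ 2)) :
    ThetaBdd r ((c + 1) / 2) p := by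
  have half : ∀ q : MvPolynomial (Fin n) ℝ, q ^ 2 = p ^ 2 →
      ((c + 1) / 2) • Theta n r + q ∈ sumSqCone (Fin n) := fun q hq => by
    have h := smul_mem_sumSqCone (c := 1 / 2) (by norm_num)
      (add_mem (add_mem hp.2 (Theta_sub_one_mem (n := n) r)) (sq_mem_sumSqCone (1 + q)))
    convert h using 1
    rw [← hq, show (1 + q) ^ 2 = 1 + (2 : ℝ) • q + q ^ 2 by
      rw [smul_eq_C_mul, show (C 2 : MvPolynomial (Fin n) ℝ) = 2 from rfl]; ring]
    module
  exact ⟨half p rfl, by simpa [sub_eq_add_neg] using half (-p) (by ring)⟩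

theorem ThetaBdd.sq_mul_sq {r : ℕ} {c c' : ℝ} {p q : MvPolynomial (Fin n) ℝ}
    (hp : ThetaBdd r c (p ^ 4)) (hq : ThetaBdd r c' (q ^ 4)) :
    ThetaBdd r ((c + c') / 2) ((p * q) ^ 2) := by
  have h := smul_mem_sumSqCone (c := 1 / 2) (by norm_num)
      (add_mem (add_mem hp.2 hq.2) (sq_mem_sumSqCone (p ^ 2 - q ^ 2)))
  have h' : ((c + c') / 2) • Theta n r - (p * q) ^ 2 ∈ sumSqCone (Fin n) := by
    convert h using 1
    rw [show (p ^ 2 - q ^ 2) ^ 2 = p ^ 4 + q ^ 4 - (2 : ℝ) • (p * q) ^ 2 by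
      rw [smul_eq_C_mul, show (C 2 : MvPolynomial (Fin n) ℝ) = 2 from rfl]; ring]
    module
  refine ⟨?_, h'⟩
  convert add_mem h' (smul_mem_sumSqCone (c := 2) (by norm_num) (sq_mem_sumSqCone (p * q))) using 1
  module

/-- Every polynomial is bounded by a multiple of `Θ_r`, uniformly in large `r`. -/
theorem exists_eventually_thetaBdd (p : MvPolynomial (Fin n) ℝ) :
    ∃ c : ℝ, ∀ᶠ r in atTop, ThetaBdd r c p := by
  have hsq : ∀ p : MvPolynomial (Fin n) ℝ, (∃ c : ℝ, ∀ᶠ r in atTop, ThetaBdd r c (p ^ 2)) →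
      ∃ c : ℝ, ∀ᶠ r in atTop, ThetaBdd r c p :=
    fun p ⟨c, hc⟩ => ⟨_, hc.mono fun r hr => hr.of_sq⟩
  have hone : ∃ c : ℝ, ∀ᶠ r in atTop, ThetaBdd r c (1 : MvPolynomial (Fin n) ℝ) :=
    ⟨1, Eventually.of_forall fun r =>
      ⟨by simpa using add_mem (Theta_mem_sumSqCone r) IsSumSq.one,
        by simpa using Theta_sub_one_mem r⟩⟩
  have hC : ∀ a : ℝ, ∃ c : ℝ, ∀ᶠ r in atTop, ThetaBdd r c (C a : MvPolynomial (Fin n) ℝ) := by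
    obtain ⟨c, hc⟩ := hone
    refine fun a => ⟨|a| * c, hc.mono fun r hr => ?_⟩
    simpa [smul_eq_C_mul] using hr.smul a
  have hX : ∀ (i : Fin n) (k : ℕ),
      ∃ c : ℝ, ∀ᶠ r in atTop, ThetaBdd r c (X i ^ k : MvPolynomial (Fin n) ℝ) := by
    refine fun i k => hsq _ ⟨1, (eventually_ge_atTop k).mono fun r hr => ?_⟩
    rw [ThetaBdd, one_smul]
    refine ⟨add_mem (Theta_mem_sumSqCone r) (sq_mem_sumSqCone _), ?_⟩
    rw [← pow_mul, mul_comm k]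
    exact Theta_sub_X_pow_mem i hr
  have hmon : ∀ (m : Fin n →₀ ℕ) (a : ℝ) (k : ℕ),
      ∃ c : ℝ, ∀ᶠ r in atTop, ThetaBdd r c (monomial m a ^ k : MvPolynomial (Fin n) ℝ) := by
    intro m a
    refine induction_on_monomial
      (motive := fun q => ∀ k : ℕ, ∃ c : ℝ, ∀ᶠ r in atTop, ThetaBdd r c (q ^ k))
      (fun a k => by simpa using hC (a ^ k)) (fun p i hp k => ?_) m a
    obtain ⟨c, hc⟩ := hp (k * 4)
    obtain ⟨c', hc'⟩ := hX i (k * 4)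
    refine hsq _ ⟨(c + c') / 2, (hc.and hc').mono fun r hr => ?_⟩
    rw [mul_pow]
    exact ThetaBdd.sq_mul_sq (by simpa [← pow_mul] using hr.1) (by simpa [← pow_mul] using hr.2)
  induction p using MvPolynomial.induction_on' with
  | monomial m a => simpa using hmon m a 1
  | add p q hp hq =>
    obtain ⟨c, hc⟩ := hp
    obtain ⟨c', hc'⟩ := hq
    exact ⟨c + c', (hc.and hc').mono fun r hr => hr.1.add hr.2⟩

/-- The subspace of polynomials bounded by a multiple of `Θ_r` modulo sums of squares. -/
def thetaBddSubmodule (n r : ℕ) : Submodule ℝ (MvPolynomial (Fin n) ℝ) where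
  carrier := {p | ∃ c : ℝ, ThetaBdd r c p}
  add_mem' := fun ⟨_, h⟩ ⟨_, h'⟩ => ⟨_, h.add h'⟩
  zero_mem' := ⟨0, by simp [ThetaBdd]⟩
  smul_mem' := fun a _ ⟨_, h⟩ => ⟨_, h.smul a⟩

/-- If `f + ε Θ_r` is not a sum of squares, this is witnessed by a functional. -/
theorem exists_linearMap_of_not_isSumSq {r : ℕ} {ε : ℝ} {f : MvPolynomial (Fin n) ℝ}
    (hf : f ∈ thetaBddSubmodule n r) (hfs : ¬ IsSumSq (f + C ε * Theta n r)) :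
    ∃ L : MvPolynomial (Fin n) ℝ →ₗ[ℝ] ℝ, L f ≤ -ε ∧ (∀ p ∈ thetaBddSubmodule n r,
      IsSumSq p → 0 ≤ L p) ∧ (∀ c p, ThetaBdd r c p → |L p| ≤ c) ∧
      ∀ i k, k ≤ r → L (X i ^ (2 * k)) ≤ 1 := by
  have hΘ : Theta n r ∈ thetaBddSubmodule n r :=
    ⟨1, by simpa using add_mem (Theta_mem_sumSqCone r) (Theta_mem_sumSqCone r), by simp⟩
  obtain ⟨L, h1, h2, h3⟩ := (sumSqCone (Fin n)).exists_linearMap_separating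
    (thetaBddSubmodule n r) hΘ (add_mem hf ((thetaBddSubmodule n r).smul_mem ε hΘ))
    (Theta_mem_sumSqCone r) (neg_Theta_notMem_sumSqCone r)
    (by rwa [mem_sumSqCone, smul_eq_C_mul]) (fun v ⟨c, hc⟩ => ⟨c, hc.1⟩)
  refine ⟨L, ?_, h3, fun c p hp => ?_, fun i k hk => ?_⟩
  · simp only [map_add, map_smul, h1, smul_eq_mul] at h2
    linarith
  · have hpV : p ∈ thetaBddSubmodule n r := ⟨c, hp⟩
    have hcV := (thetaBddSubmodule n r).smul_mem c hΘ
    have ha := h3 _ (add_mem hcV hpV) hp.1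
    have hb := h3 _ (sub_mem hcV hpV) hp.2
    simp only [map_add, map_sub, map_smul, h1, smul_eq_mul] at ha hb
    exact abs_le.2 ⟨by linarith, by linarith⟩
  · have hk' := Theta_sub_X_pow_mem i hk
    have hV : X i ^ (2 * k) ∈ thetaBddSubmodule n r := by
      refine ⟨1, ?_, by simpa using hk'⟩
      rw [one_smul, mul_comm 2 k, pow_mul]
      exact add_mem (Theta_mem_sumSqCone r) (sq_mem_sumSqCone _)
    have := h3 _ (sub_mem hΘ hV) hk'
    rw [map_sub, h1] at this
    linarith

end OrderUnit

section MomentFunctional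

variable {σ : Type*}

/-- A functional that is nonnegative on squares and whose even pure moments are bounded. -/
structure IsBddMoment (φ : MvPolynomial σ ℝ →ₗ[ℝ] ℝ) : Prop where
  nonneg : ∀ p, 0 ≤ φ (p * p)
  bdd : ∃ c : ℝ, ∀ i k, φ (X i ^ (2 * k)) ≤ c

theorem le_of_convex_of_bdd {a : ℕ → ℝ} {c : ℝ} (hconv : ∀ k, 2 * a (k + 1) ≤ a k + a (k + 2))
    (hc : ∀ k, a k ≤ c) : a 1 ≤ a 0 := by
  by_contra! h
  have hstep : ∀ k, a 1 - a 0 ≤ a (k + 1) - a k := by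
    intro k
    induction k with
    | zero => simp
    | succ k ih => linarith [hconv k]
  have hlin : ∀ k : ℕ, a 0 + k * (a 1 - a 0) ≤ a k := by
    intro k
    induction k with
    | zero => simp
    | succ k ih => push_cast; linarith [hstep k]
  obtain ⟨k, hk⟩ := exists_nat_gt ((c - a 0) / (a 1 - a 0))
  rw [div_lt_iff₀ (by linarith)] at hk
  linarith [hlin k, hc k]

namespace IsBddMoment

variable {φ : MvPolynomial σ ℝ →ₗ[ℝ] ℝ}

theorem two_mul_le (h : IsBddMoment φ) (p q : MvPolynomial σ ℝ) :
    2 * φ (p * q) ≤ φ (p * p) + φ (q * q) := by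
  have := h.nonneg (p - q)
  rw [show (p - q) * (p - q) = p * p + q * q - (p * q + p * q) by ring] at this
  simp only [map_add, map_sub] at this
  linarith

theorem mul_X_le (h : IsBddMoment φ) (p : MvPolynomial σ ℝ) (i : σ) :
    φ ((p * X i) * (p * X i)) ≤ φ (p * p) := by
  obtain ⟨c, hc⟩ := h.bdd
  have := le_of_convex_of_bdd (a := fun k => φ (p * X i ^ k * (p * X i ^ k)))
    (c := (φ (p * p * (p * p)) + c) / 2) (fun k => ?_) (fun k => ?_)
  · simpa using this
  · convert h.two_mul_le (p * X i ^ k) (p * X i ^ (k + 2)) using 3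
    ring_nf
  · have h1 := h.two_mul_le (p * p) (X i ^ (2 * k))
    have h2 := hc i (2 * k)
    rw [show (X i ^ (2 * k) * X i ^ (2 * k) : MvPolynomial σ ℝ) = X i ^ (2 * (2 * k)) by ring,
      show p * p * X i ^ (2 * k) = p * X i ^ k * (p * X i ^ k) by ring] at h1
    linarith

theorem monomial_mul_self_le (h : IsBddMoment φ) (m : σ →₀ ℕ) :
    φ (monomial m 1 * monomial m 1) ≤ φ 1 := by
  induction m using Finsupp.induction with
  | zero => simp
  | single_add i k f _ _ ih =>
    have hstep : ∀ k : ℕ, φ (monomial f 1 * X i ^ k * (monomial f 1 * X i ^ k)) ≤ φ 1 := by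
      intro k
      induction k with
      | zero => simpa using ih
      | succ k ihk => simpa only [pow_succ, mul_assoc] using (h.mul_X_le _ i).trans ihk
    rw [add_comm, ← one_mul (1 : ℝ), ← monomial_mul, ← X_pow_eq_monomial]
    exact hstep k

theorem abs_monomial_le (h : IsBddMoment φ) (m : σ →₀ ℕ) : |φ (monomial m 1)| ≤ φ 1 := by
  have hm := h.monomial_mul_self_le m
  have h1 := h.two_mul_le (monomial m 1) 1
  have h2 := h.two_mul_le (-monomial m 1) 1
  simp only [mul_one, map_neg, neg_mul_neg] at h1 h2
  exact abs_le.2 ⟨by linarith, by linarith⟩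

theorem abs_X_le (h : IsBddMoment φ) (i : σ) : |φ (X i)| ≤ φ 1 := h.abs_monomial_le _

theorem X_pow_le (h : IsBddMoment φ) (i : σ) (k : ℕ) : φ (X i ^ k) ≤ φ 1 := by
  rw [X_pow_eq_monomial]
  exact (abs_le.1 (h.abs_monomial_le _)).2

theorem abs_le_sum (h : IsBddMoment φ) (p : MvPolynomial σ ℝ) :
    |φ p| ≤ (∑ m ∈ p.support, |p.coeff m|) * φ 1 := by
  conv_lhs => rw [p.as_sum]
  rw [map_sum, Finset.sum_mul]
  refine (Finset.abs_sum_le_sum_abs _ _).trans (Finset.sum_le_sum fun m _ => ?_)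
  rw [← mul_one (p.coeff m), ← smul_eq_mul, ← smul_monomial, map_smul, smul_eq_mul, abs_mul,
    smul_eq_mul, mul_one]
  exact mul_le_mul_of_nonneg_left (h.abs_monomial_le m) (abs_nonneg _)

/-- The class is stable under multiplication by `2 + s X_i`, `s = ±1`. -/
theorem two_add_X (h : IsBddMoment φ) (i : σ) {s : ℝ} (hs : s * s = 1) :
    IsBddMoment ((2 : ℝ) • φ + s • φ ∘ₗ LinearMap.mulLeft ℝ (X i)) := by
  refine ⟨fun p => ?_, 3 * φ 1, fun j k => ?_⟩
  · have h1 := h.mul_X_le p i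
    have h2 := h.two_mul_le (-(s • (p * X i))) p
    have h3 := h.nonneg p
    rw [neg_mul_neg, neg_mul, map_neg, smul_mul_assoc, smul_mul_smul_comm, hs, one_smul,
      map_smul, show p * X i * p = X i * (p * p) by ring] at h2
    simp only [LinearMap.add_apply, LinearMap.smul_apply, LinearMap.comp_apply,
      LinearMap.mulLeft_apply, smul_eq_mul] at h2 ⊢
    linarith
  · have h1 := h.X_pow_le j (2 * k)
    have h2 : |φ (X i * X j ^ (2 * k))| ≤ φ 1 := by
      rw [X_pow_eq_monomial, X, monomial_mul, one_mul]
      exact h.abs_monomial_le _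
    have h3 : |s| = 1 := by
      rcases mul_self_eq_one_iff.1 hs with rfl | rfl <;> simp
    have h4 : s * φ (X i * X j ^ (2 * k)) ≤ φ 1 := by
      refine (le_abs_self _).trans ?_
      rwa [abs_mul, h3, one_mul]
    simp only [LinearMap.add_apply, LinearMap.smul_apply, LinearMap.comp_apply,
      LinearMap.mulLeft_apply, smul_eq_mul]
    linarith

theorem smul (h : IsBddMoment φ) {c : ℝ} (hc : 0 ≤ c) : IsBddMoment (c • φ) := by
  refine ⟨fun p => mul_nonneg hc (h.nonneg p), c * φ 1, fun i k => ?_⟩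
  exact mul_le_mul_of_nonneg_left (h.X_pow_le i (2 * k)) hc

end IsBddMoment

/-- The normalized bounded moment functionals, as a subset of a product space. -/
def momentStates (σ : Type*) : Set (MvPolynomial σ ℝ → ℝ) :=
  {ψ | ∃ φ : MvPolynomial σ ℝ →ₗ[ℝ] ℝ, ⇑φ = ψ ∧ IsBddMoment φ ∧ φ 1 = 1}

theorem isCompact_momentStates : IsCompact (momentStates σ) := by
  have hK : momentStates σ = {ψ | (∀ p q, ψ (p + q) = ψ p + ψ q) ∧
      (∀ (c : ℝ) p, ψ (c • p) = c * ψ p) ∧ (∀ p, 0 ≤ ψ (p * p)) ∧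
      (∀ i k, ψ (X i ^ (2 * k)) ≤ 1) ∧ ψ 1 = 1} := by
    ext ψ
    constructor
    · rintro ⟨φ, rfl, h, h1⟩
      exact ⟨map_add φ, map_smul φ, h.nonneg, fun i k => h1 ▸ h.X_pow_le i (2 * k), h1⟩
    · rintro ⟨ha, hs, hp, hb, h1⟩
      exact ⟨⟨⟨ψ, ha⟩, hs⟩, rfl, ⟨hp, 1, hb⟩, h1⟩
  refine IsCompact.of_isClosed_subset
    (isCompact_univ_pi fun p : MvPolynomial σ ℝ =>
      isCompact_Icc (a := -∑ m ∈ p.support, |p.coeff m|) (b := ∑ m ∈ p.support, |p.coeff m|)) ?_ ?_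
  · rw [hK]
    simp only [Set.ofPred_and, Set.ofPred_forall]
    refine (isClosed_iInter fun p => isClosed_iInter fun q => isClosed_eq ?_ ?_).inter
      ((isClosed_iInter fun c => isClosed_iInter fun p => isClosed_eq ?_ ?_).inter
      ((isClosed_iInter fun p => isClosed_le ?_ ?_).inter
      ((isClosed_iInter fun i => isClosed_iInter fun k => isClosed_le ?_ ?_).inter
      (isClosed_eq ?_ ?_)))) <;> fun_prop
  · rintro _ ⟨φ, rfl, h, h1⟩ p -
    have := h.abs_le_sum p
    rw [h1, mul_one] at this
    exact abs_le.1 this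

theorem eq_of_le_of_convex_comb {a b u v m : ℝ} (ha : 0 < a) (hb : 0 < b) (hab : a + b = 1)
    (hu : m ≤ u) (hv : m ≤ v) (h : a * u + b * v = m) : u = m ∧ v = m := by
  have h1 : a * (u - m) + b * (v - m) = 0 := by
    linear_combination h - m * hab
  have hu' := mul_nonneg ha.le (sub_nonneg.2 hu)
  have hv' := mul_nonneg hb.le (sub_nonneg.2 hv)
  constructor
  · have : a * (u - m) = 0 := by linarith
    linarith [(mul_eq_zero.1 this).resolve_left ha.ne']
  · have : b * (v - m) = 0 := by linarith
    linarith [(mul_eq_zero.1 this).resolve_left hb.ne']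

/-- An extreme point of a face of the state space cut out by minimizing at `f` is a character. -/
theorem map_X_mul_of_mem_extremePoints {f : MvPolynomial σ ℝ} {φ : MvPolynomial σ ℝ →ₗ[ℝ] ℝ}
    (h : IsBddMoment φ) (h1 : φ 1 = 1) (hmin : ∀ ψ ∈ momentStates σ, φ f ≤ ψ f)
    (hext : ⇑φ ∈ {ψ ∈ momentStates σ | ψ f = φ f}.extremePoints ℝ) (i : σ)
    (p : MvPolynomial σ ℝ) : φ (X i * p) = φ (X i) * φ p := by
  have hX := abs_le.1 (h1 ▸ h.abs_X_le i)
  let T : ℝ → MvPolynomial σ ℝ →ₗ[ℝ] ℝ := fun s =>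
    (2 : ℝ) • φ + s • φ ∘ₗ LinearMap.mulLeft ℝ (X i)
  have hTapp : ∀ s q, T s q = 2 * φ q + s * φ (X i * q) := fun s q => rfl
  have hT1 : ∀ s, T s 1 = 2 + s * φ (X i) := fun s => by rw [hTapp, h1, mul_one, mul_one]
  have hpos : ∀ s : ℝ, s * s = 1 → 0 < T s 1 := fun s hs => by
    rw [hT1]
    rcases mul_self_eq_one_iff.1 hs with rfl | rfl <;> linarith
  have hstate : ∀ s : ℝ, s * s = 1 → ⇑((T s 1)⁻¹ • T s) ∈ momentStates σ := fun s hs =>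
    ⟨_, rfl, (h.two_add_X i hs).smul (inv_nonneg.2 (hpos s hs).le),
      inv_mul_cancel₀ (hpos s hs).ne'⟩
  have hp := hstate 1 (by norm_num)
  have hm := hstate (-1) (by norm_num)
  have hpp := hpos 1 (by norm_num)
  have hmp := hpos (-1) (by norm_num)
  have hsum : ∀ q, (T 1 1 / 4) * ((T 1 1)⁻¹ • T 1) q + (T (-1) 1 / 4) * ((T (-1) 1)⁻¹ • T (-1)) q
      = φ q := fun q => by
    have h4 : T 1 q + T (-1) q = 4 * φ q := by rw [hTapp, hTapp]; ring
    simp only [LinearMap.smul_apply, smul_eq_mul]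
    field_simp
    linarith
  have hcoef : T 1 1 / 4 + T (-1) 1 / 4 = 1 := by rw [hT1, hT1]; ring
  have hpf := hmin _ hp
  have hmf := hmin _ hm
  have hf := hsum f
  obtain ⟨hpf', hmf'⟩ := eq_of_le_of_convex_comb (by positivity) (by positivity) hcoef hpf hmf hf
  have heq := hext.2 ⟨hp, hpf'⟩ ⟨hm, hmf'⟩
    ⟨T 1 1 / 4, T (-1) 1 / 4, by positivity, by positivity, hcoef, funext hsum⟩
  have hpe := congrFun heq p
  rw [LinearMap.smul_apply, smul_eq_mul, inv_mul_eq_iff_eq_mul₀ hpp.ne', hTapp, hT1] at hpe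
  linarith

/-- A bounded moment functional is nonnegative at polynomials nonnegative on the cube. -/
theorem IsBddMoment.nonneg_of_nonneg_on_cube {φ : MvPolynomial σ ℝ →ₗ[ℝ] ℝ} (h : IsBddMoment φ)
    {f : MvPolynomial σ ℝ} (hf : ∀ x : σ → ℝ, (∀ i, |x i| ≤ 1) → 0 ≤ eval x f) : 0 ≤ φ f := by
  rcases (show 0 ≤ φ 1 by simpa using h.nonneg 1).eq_or_lt with h0 | h0
  · have := h.abs_le_sum f
    rw [← h0, mul_zero] at this
    exact (abs_nonpos_iff.1 this).ge
  have hφ : ⇑((φ 1)⁻¹ • φ) ∈ momentStates σ :=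
    ⟨_, rfl, h.smul (inv_nonneg.2 h0.le), inv_mul_cancel₀ h0.ne'⟩
  obtain ⟨ψ₀, hψ₀, hmin⟩ := isCompact_momentStates.exists_isMinOn ⟨_, hφ⟩
    (continuous_apply f).continuousOn
  have hclosed : IsClosed {ψ : MvPolynomial σ ℝ → ℝ | ψ f = ψ₀ f} :=
    isClosed_eq (continuous_apply f) continuous_const
  obtain ⟨ψ, hψ⟩ := (isCompact_momentStates.inter_right hclosed).extremePoints_nonempty
    ⟨ψ₀, hψ₀, rfl⟩
  obtain ⟨⟨χ, rfl, hχ, h1⟩, hχf⟩ := hψ.1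
  replace hχf : χ f = ψ₀ f := hχf
  have hminχ : ∀ θ ∈ momentStates σ, χ f ≤ θ f := fun θ hθ => hχf ▸ hmin hθ
  have hmul := map_X_mul_of_mem_extremePoints hχ h1 hminχ (by rw [hχf]; exact hψ)
  have heval : ∀ p, χ p = eval (fun i => χ (X i)) p := by
    intro p
    induction p using MvPolynomial.induction_on with
    | C a => rw [← mul_one (C a), ← smul_eq_C_mul, map_smul, h1, smul_eval, map_one]; rfl
    | add p q hp hq => rw [map_add, map_add, hp, hq]
    | mul_X p i hp => rw [mul_comm, hmul, map_mul, eval_X, hp]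
  have hχ0 : 0 ≤ χ f := by
    rw [heval]
    exact hf _ fun i => h1 ▸ hχ.abs_X_le i
  have := hχ0.trans (hminχ _ hφ)
  exact nonneg_of_mul_nonneg_right (a := (φ 1)⁻¹) this (inv_pos.2 h0)

end MomentFunctional

section Limit

variable {n : ℕ}

theorem eventually_mem_thetaBddSubmodule (n d : ℕ) : ∀ᶠ r in atTop,
    ∀ f : MvPolynomial (Fin n) ℝ, f.totalDegree ≤ d → f ∈ thetaBddSubmodule n r := by
  have hfin := Finsupp.finite_of_degree_le (σ := Fin n) d
  have : ∀ m ∈ {m : Fin n →₀ ℕ | m.degree ≤ d}, ∀ᶠ r in atTop,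
      monomial m (1 : ℝ) ∈ thetaBddSubmodule n r := fun m _ => by
    obtain ⟨c, hc⟩ := exists_eventually_thetaBdd (monomial m (1 : ℝ))
    exact hc.mono fun r hr => ⟨c, hr⟩
  refine ((eventually_all_finite hfin).2 this).mono fun r hr f hf => ?_
  rw [f.as_sum]
  refine sum_mem fun m hm => ?_
  rw [← mul_one (f.coeff m), ← smul_eq_mul, ← smul_monomial]
  exact Submodule.smul_mem _ _ (hr m ((le_totalDegree hm).trans hf))

/-- Along an ultrafilter, functionals bounded at each polynomial converge. -/
theorem exists_linearMap_tendsto {E : Type*} [AddCommGroup E] [Module ℝ E] {ι : Type*}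
    (U : Ultrafilter ι) (L : ι → E →ₗ[ℝ] ℝ) (hL : ∀ p, ∃ c, ∀ᶠ k in U, |L k p| ≤ c) :
    ∃ φ : E →ₗ[ℝ] ℝ, ∀ p, Tendsto (fun k => L k p) U (𝓝 (φ p)) := by
  have hlim : ∀ p, ∃ y, Tendsto (fun k => L k p) U (𝓝 y) := fun p => by
    obtain ⟨c, hc⟩ := hL p
    obtain ⟨y, -, hy⟩ := isCompact_Icc.ultrafilter_le_nhds (U.map fun k => L k p)
      (le_principal_iff.2 (hc.mono fun k hk => abs_le.1 hk) : _ ≤ 𝓟 (Set.Icc (-c) c))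
    exact ⟨y, hy⟩
  choose φ hφ using hlim
  refine ⟨⟨⟨φ, fun p q => ?_⟩, fun a p => ?_⟩, hφ⟩
  · refine tendsto_nhds_unique (hφ (p + q)) ?_
    simpa only [map_add] using (hφ p).add (hφ q)
  · refine tendsto_nhds_unique (hφ (a • p)) ?_
    simpa only [map_smul, RingHom.id_apply] using (hφ p).const_smul a

/-- Along an ultrafilter, polynomials of bounded degree and coefficients converge. -/
theorem exists_polynomial_tendsto {σ ι : Type*} [Finite σ] (U : Ultrafilter ι)
    (f : ι → MvPolynomial σ ℝ) {d : ℕ} {N : ℝ} (hd : ∀ k, (f k).totalDegree ≤ d)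
    (hN : ∀ k m, |(f k).coeff m| ≤ N) :
    ∃ g : MvPolynomial σ ℝ, ∀ (L : ι → MvPolynomial σ ℝ →ₗ[ℝ] ℝ) (φ : MvPolynomial σ ℝ →ₗ[ℝ] ℝ),
      (∀ p, Tendsto (fun k => L k p) U (𝓝 (φ p))) →
      Tendsto (fun k => L k (f k)) U (𝓝 (φ g)) := by
  let T := (Finsupp.finite_of_degree_le (σ := σ) d).toFinset
  have hlim : ∀ m, ∃ y, Tendsto (fun k => (f k).coeff m) U (𝓝 y) := fun m => by
    obtain ⟨y, -, hy⟩ := isCompact_Icc.ultrafilter_le_nhds (U.map fun k => (f k).coeff m)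
      (le_principal_iff.2 (Eventually.of_forall (f := (U : Filter ι)) fun k => abs_le.1 (hN k m)) :
        _ ≤ 𝓟 (Set.Icc (-N) N))
    exact ⟨y, hy⟩
  choose a ha using hlim
  have hsum : ∀ k, f k = ∑ m ∈ T, (f k).coeff m • monomial m (1 : ℝ) := fun k => by
    conv_lhs => rw [(f k).as_sum]
    simp only [smul_monomial, smul_eq_mul, mul_one]
    refine Finset.sum_subset (fun m hm => ?_) fun m _ hm => ?_
    · exact (Set.Finite.mem_toFinset _).2 ((le_totalDegree hm).trans (hd k))
    · rw [notMem_support_iff.1 hm, map_zero]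
  refine ⟨∑ m ∈ T, a m • monomial m (1 : ℝ), fun L φ hL => ?_⟩
  have hLf : ∀ k, L k (f k) = ∑ m ∈ T, (f k).coeff m * L k (monomial m 1) := fun k => by
    conv_lhs => rw [hsum k]
    simp only [map_sum, map_smul, smul_eq_mul]
  simp only [hLf, map_sum, map_smul, smul_eq_mul]
  exact tendsto_finsetSum _ fun m _ => (ha m).mul (hL _)

end Limit

/-- For given `n, N, d ∈ ℕ` and `ε > 0` there is `r = r(n,N,d,ε)` such that for every
`f` of degree at most `d`, coefficients bounded by `N`, and nonnegative on `[-1,1]^n`,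
the polynomial `f + ε Θ_{r'}` is a sum of squares for every `r' ≥ r`. -/
theorem stmt_12 (n N d : ℕ) (ε : ℝ) (hε : 0 < ε) :
    ∃ r : ℕ, ∀ f : MvPolynomial (Fin n) ℝ,
      f.totalDegree ≤ d →
      (∀ m : (Fin n) →₀ ℕ, |f.coeff m| ≤ (N : ℝ)) →
      (∀ x : Fin n → ℝ, (∀ i, |x i| ≤ 1) → 0 ≤ eval x f) →
      ∀ r' : ℕ, r ≤ r' → IsSumSq (f + C ε * Theta n r') := by
  by_contra! H
  obtain ⟨r₀, hr₀⟩ := eventually_atTop.1 (eventually_mem_thetaBddSubmodule n d)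
  choose f hd hN hf ρ hρ hns using fun k => H (r₀ + k)
  choose L hLf hLpos hLbdd hLX using fun k =>
    exists_linearMap_of_not_isSumSq (hr₀ (ρ k) (by linarith [hρ k]) _ (hd k)) (hns k)
  let U : Ultrafilter ℕ := hyperfilter ℕ
  have hU : Tendsto ρ U atTop :=
    (tendsto_atTop_mono (fun k => (Nat.le_add_left k r₀).trans (hρ k)) tendsto_id).mono_left
      (Nat.cofinite_eq_atTop ▸ hyperfilter_le_cofinite)
  obtain ⟨φ, hφ⟩ := exists_linearMap_tendsto U L fun p => by
    obtain ⟨c, hc⟩ := exists_eventually_thetaBdd p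
    exact ⟨c, (hU.eventually hc).mono fun k hk => hLbdd k c p hk⟩
  have hφm : IsBddMoment φ := by
    refine ⟨fun p => ge_of_tendsto (hφ _) ?_, 1, fun i j => le_of_tendsto (hφ _) ?_⟩
    · obtain ⟨c, hc⟩ := exists_eventually_thetaBdd (p * p)
      exact (hU.eventually hc).mono fun k hk => hLpos k _ ⟨c, hk⟩ (IsSumSq.mul_self p)
    · exact (hU.eventually (eventually_ge_atTop j)).mono fun k hk => hLX k i j hk
  obtain ⟨g, hg⟩ := exists_polynomial_tendsto U f hd hN
  have hgcube : ∀ x : Fin n → ℝ, (∀ i, |x i| ≤ 1) → 0 ≤ eval x g := fun x hx =>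
    ge_of_tendsto (hg (fun _ => (aeval x).toLinearMap) (aeval x).toLinearMap
      fun p => tendsto_const_nhds) (Eventually.of_forall fun k => by
        simpa [aeval_eq_eval] using hf k x hx)
  have h1 : φ g ≤ -ε := le_of_tendsto (hg L φ hφ) (Eventually.of_forall hLf)
  linarith [hφm.nonneg_of_nonneg_on_cube hgcube]
end

section
/- Let L be a linear functional on the space of univariate real polynomials of degree at most 2r such that L(p²) ≥ 0 for every univariate polynomial p of degree at most r. Then L(X^{2k}) ≤ max(L(1), L(X^{2r})) for all k = 0,…,r. -/
open Polynomial

/-- A discretely convex sequence on `{0, …, r}` attains its maximum at an endpoint. -/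
theorem le_max_endpoints_of_discrete_convex (a : ℕ → ℝ) (r : ℕ)
    (h : ∀ k, k + 2 ≤ r → 2 * a (k + 1) ≤ a k + a (k + 2)) :
    ∀ k, k ≤ r → a k ≤ max (a 0) (a r) := by
  induction r with
  | zero => intro k hk; simp [Nat.le_zero.mp hk]
  | succ r ih =>
    have ih' := ih fun k hk => h k (by omega)
    have key : a r ≤ max (a 0) (a (r + 1)) := by
      rcases r with _ | s
      · exact le_max_left _ _
      · have hs := ih' s (by omega)
        have hc := h s le_rfl
        rcases le_max_iff.mp hs with h0 | h1
        · rw [le_max_iff]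
          by_contra! hlt
          linarith [hlt.1, hlt.2]
        · exact le_max_of_le_right (by linarith)
    intro k hk
    rcases hk.eq_or_lt with rfl | hlt
    · exact le_max_right _ _
    · exact (ih' k (by omega)).trans (max_le (le_max_left _ _) key)

/-- If `L` is a linear functional on univariate polynomials (of degree at most `2r`)
with `L(p²) ≥ 0` for all `p` of degree at most `r`, then
`L(X^{2k}) ≤ max (L 1) (L (X^{2r}))` for all `k = 0,…,r`. -/
theorem stmt_13 (r : ℕ) (L : Polynomial ℝ →ₗ[ℝ] ℝ)
    (hpos : ∀ p : Polynomial ℝ, p.natDegree ≤ r → 0 ≤ L (p ^ 2)) :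
    ∀ k : ℕ, k ≤ r → L (X ^ (2 * k)) ≤ max (L 1) (L (X ^ (2 * r))) := by
  have hconv : ∀ k, k + 2 ≤ r →
      2 * L (X ^ (2 * (k + 1))) ≤ L (X ^ (2 * k)) + L (X ^ (2 * (k + 2))) := by
    intro k hk
    have hdeg : (X ^ (k + 2) - X ^ k : ℝ[X]).natDegree ≤ r :=
      natDegree_sub_le_of_le (by rw [natDegree_X_pow]; exact hk)
        (by rw [natDegree_X_pow]; omega) |>.trans (max_self r).le
    have hsq : (X ^ (k + 2) - X ^ k : ℝ[X]) ^ 2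
        = X ^ (2 * (k + 2)) - (2 : ℝ) • X ^ (2 * (k + 1)) + X ^ (2 * k) := by
      rw [two_smul]
      ring
    have hnonneg := hpos _ hdeg
    rw [hsq, map_add, map_sub, map_smul, smul_eq_mul] at hnonneg
    linarith
  simpa using le_max_endpoints_of_discrete_convex (fun k => L (X ^ (2 * k))) r hconv
end

section
/- Let r ≥ 2 be a natural number and let ε > 0 be real. The univariate polynomial 1 − X² + ε·X^{2r} is nonnegative on all of ℝ (equivalently, a sum of squares) if and only if ε ≥ (r−1)^{r−1}/r^r. -/
open Polynomial

/-- For `r ≥ 2` and `ε > 0`, the polynomial `1 - X² + ε X^{2r}` is nonnegative on `ℝ`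
(equivalently, a sum of squares) if and only if `ε ≥ (r-1)^{r-1}/r^r`. -/
theorem stmt_16 (r : ℕ) (hr : 2 ≤ r) (ε : ℝ) (hε : 0 < ε) :
    (∀ x : ℝ, 0 ≤ eval x (1 - X ^ 2 + C ε * X ^ (2 * r))) ↔
      ((r : ℝ) - 1) ^ (r - 1) / (r : ℝ) ^ r ≤ ε := by
  obtain ⟨n, rfl⟩ : ∃ n, r = n + 1 := ⟨r - 1, by omega⟩
  have hn : (0 : ℝ) < n := by exact_mod_cast (by omega : 0 < n)
  have hn1 : (0 : ℝ) < n + 1 := by positivity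
  simp only [eval_add, eval_sub, eval_one, eval_pow, eval_X, eval_mul, eval_C, pow_mul,
    Nat.cast_add, Nat.cast_one, add_sub_cancel_right, Nat.add_sub_cancel]
  constructor
  · intro h
    have hy := h (√(((n : ℝ) + 1) / n))
    rw [Real.sq_sqrt (by positivity), div_pow] at hy
    rw [div_le_iff₀ (by positivity)]
    have hscaled := mul_nonneg hy (pow_pos hn (n + 1)).le
    have hid : (1 - ((n : ℝ) + 1) / n + ε * (((n : ℝ) + 1) ^ (n + 1) / (n : ℝ) ^ (n + 1))) *
        (n : ℝ) ^ (n + 1) = ε * ((n : ℝ) + 1) ^ (n + 1) - (n : ℝ) ^ n := by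
      field_simp
      ring
    linarith
  · intro h x
    have hx := sq_nonneg x
    set y := x ^ 2
    have hbern := one_add_mul_le_pow (a := y * n / (n + 1) - 1)
      (by linarith [show 0 ≤ y * n / (n + 1) by positivity]) (n + 1)
    have hpow : (1 + (y * n / (n + 1) - 1)) ^ (n + 1) =
        n * ((n : ℝ) ^ n / ((n : ℝ) + 1) ^ (n + 1) * y ^ (n + 1)) := by
      rw [add_sub_cancel, div_pow, mul_pow]
      ring
    have hlin : 1 + ((n + 1 : ℕ) : ℝ) * (y * n / (n + 1) - 1) = n * (y - 1) := by
      push_cast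
      field_simp
      ring
    rw [hpow, hlin] at hbern
    have hle := le_of_mul_le_mul_left hbern hn
    linarith [mul_le_mul_of_nonneg_right h (pow_nonneg hx (n + 1))]
end

section
/- Let f = 1 + X²Y²(X² + Y² − 3) ∈ ℝ[X,Y] be the Motzkin polynomial. Then for every natural number r ≥ 3, the polynomial f + 2^{4−2r}·X^{2r} is a sum of squares of polynomials in ℝ[X,Y]. -/
open MvPolynomial

/-- If `2` is invertible with inverse `h` and `u` is a sum of squares, then
`(1 - 4u)²(1 - u) + 16uʳ` is a sum of squares for every `r ≥ 3`. -/
theorem isSumSq_one_sub_four_mul_sq_mul_add_pow {R : Type*} [CommRing R] {h u : R}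
    (hh : 2 * h = 1) (hu : IsSumSq u) {r : ℕ} (hr : 3 ≤ r) :
    IsSumSq ((1 - 4 * u) ^ 2 * (1 - u) + 16 * u ^ r) := by
  induction r, hr using Nat.le_induction with
  | base =>
    have key : (1 - 4 * u) ^ 2 * (1 - u) + 16 * u ^ 3 =
        (1 - 9 * h * u) * (1 - 9 * h * u) + ((15 : ℕ) : R) * ((h * u) * (h * u)) := by
      push_cast
      linear_combination (9 * u - 24 * u ^ 2 * (2 * h + 1)) * hh
    rw [key]
    exact (IsSumSq.mul_self _).add ((IsSumSq.natCast 15).mul (IsSumSq.mul_self _))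
  | succ r _ ih =>
    have key : (1 - 4 * u) ^ 2 * (1 - u) + 16 * u ^ (r + 1) =
        ((1 - 4 * u) * (1 - u)) * ((1 - 4 * u) * (1 - u)) +
          u * ((1 - 4 * u) ^ 2 * (1 - u) + 16 * u ^ r) := by
      ring
    rw [key]
    exact (IsSumSq.mul_self _).add (hu.mul ih)

/-- For the Motzkin polynomial `f = 1 + X²Y²(X² + Y² − 3)` and every `r ≥ 3`, the
polynomial `f + 2^{4-2r} X^{2r}` is a sum of squares. -/
theorem stmt_17 (r : ℕ) (hr : 3 ≤ r) :
    IsSumSq ((1 + X 0 ^ 2 * X 1 ^ 2 * (X 0 ^ 2 + X 1 ^ 2 - 3) : MvPolynomial (Fin 2) ℝ)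
      + C ((2 : ℝ) ^ (4 - 2 * (r : ℤ))) * X 0 ^ (2 * r)) := by
  obtain ⟨h, hh_def⟩ : ∃ h : MvPolynomial (Fin 2) ℝ, h = C (1 / 2) := ⟨_, rfl⟩
  have hh : 2 * h = 1 := by
    rw [hh_def, ← map_ofNat C 2, ← map_mul, ← map_one C]
    norm_num
  have hc : C ((2 : ℝ) ^ (4 - 2 * (r : ℤ))) = 16 * (h ^ 2) ^ r := by
    have hpow : (2 : ℝ) ^ (4 - 2 * (r : ℤ)) = 16 * ((1 / 2) ^ 2) ^ r := by
      rw [zpow_sub₀ two_ne_zero, zpow_mul, zpow_natCast, div_pow, div_pow, one_pow, one_pow]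
      norm_num [div_eq_mul_inv]
    rw [hpow, hh_def, map_mul, map_pow, map_pow, map_ofNat]
  have hu : IsSumSq ((h * X 0) * (h * X 0)) := IsSumSq.mul_self _
  have key : (1 + X 0 ^ 2 * X 1 ^ 2 * (X 0 ^ 2 + X 1 ^ 2 - 3) : MvPolynomial (Fin 2) ℝ)
      + C ((2 : ℝ) ^ (4 - 2 * (r : ℤ))) * X 0 ^ (2 * r) =
      (X 0 * (X 1 ^ 2 + h * (X 0 ^ 2 - 3))) * (X 0 * (X 1 ^ 2 + h * (X 0 ^ 2 - 3))) +
      ((1 - 4 * ((h * X 0) * (h * X 0))) ^ 2 * (1 - (h * X 0) * (h * X 0)) +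
        16 * ((h * X 0) * (h * X 0)) ^ r) := by
    have hpow : ((h * X 0) * (h * X 0)) ^ r = (h ^ 2) ^ r * X 0 ^ (2 * r) := by
      rw [pow_mul, ← mul_pow]
      ring
    have hsq : 4 * ((h * X 0) * (h * X 0)) = X 0 ^ 2 := by
      linear_combination X 0 ^ 2 * (2 * h + 1) * hh
    rw [hc, hpow, hsq]
    linear_combination
      (X 0 ^ 2 * (X 0 ^ 2 - 2) * (2 * h + 1) - X 0 ^ 2 * X 1 ^ 2 * (X 0 ^ 2 - 3)) * hh
  rw [key]
  exact (IsSumSq.mul_self _).add (isSumSq_one_sub_four_mul_sq_mul_add_pow hh hu hr)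
end

section
/- Let p = (1 − X²)²·(1 − X²/4) ∈ ℝ[X]. Then for every natural number r ≥ 3, the univariate polynomial q = p + 2^{4−2r}·X^{2r} satisfies q(x) ≥ 0 for all x ∈ ℝ. -/
open Polynomial

/-- For `p = (1 - X²)²(1 - X²/4)` and every `r ≥ 3`, the polynomial
`q = p + 2^{4-2r} X^{2r}` is nonnegative on `ℝ`. -/
theorem stmt_18 (r : ℕ) (hr : 3 ≤ r) (x : ℝ) :
    0 ≤ eval x ((1 - X ^ 2) ^ 2 * (1 - C (4⁻¹ : ℝ) * X ^ 2)
      + C ((2 : ℝ) ^ (4 - 2 * (r : ℤ))) * X ^ (2 * r)) := by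
  have h : (2 : ℝ) ^ (4 - 2 * (r : ℤ)) * x ^ (2 * r) = 16 * (x ^ 2 / 4) ^ r := by
    rw [zpow_sub₀ two_ne_zero, zpow_mul, zpow_natCast, pow_mul, div_pow]
    norm_num
    ring
  simp only [eval_add, eval_mul, eval_sub, eval_pow, eval_one, eval_X, eval_C]
  rw [h]
  have hy : 0 ≤ x ^ 2 / 4 := by positivity
  obtain ⟨y, hxy⟩ : ∃ y, y = x ^ 2 / 4 := ⟨_, rfl⟩
  rw [← hxy] at hy ⊢
  rw [show x ^ 2 = 4 * y by linarith]
  rcases le_total y 1 with hy1 | hy1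
  · have : 0 ≤ 1 - 4⁻¹ * (4 * y) := by linarith
    positivity
  · have hpow : y ^ 3 ≤ y ^ r := pow_le_pow_right₀ hy1 hr
    nlinarith [mul_nonneg hy hy]
end

section
/- Let L be a linear functional on ℝ[X_1,…,X_n] such that L(p²) ≥ 0 for all p ∈ ℝ[X_1,…,X_n]. Suppose there exist an absolute value φ : ℕⁿ → ℝ_{≥0} (i.e. φ(0) = 1 and φ(α+β) ≤ φ(α)·φ(β) for all α, β ∈ ℕⁿ) and a constant C > 0 such that |L(X^α)| ≤ C·φ(α) for all α ∈ ℕⁿ. Then L has exactly one representing measure μ on ℝⁿ (i.e. exactly one Borel measure μ such that every polynomial is μ-integrable and L(f) = ∫ f dμ for all f ∈ ℝ[X_1,…,X_n]), and the support of μ is contained in the set {x ∈ ℝⁿ : |x^α| ≤ φ(α) for all α ∈ ℕⁿ}. -/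
open MvPolynomial MeasureTheory

namespace MomentProblem

open Filter Topology

variable {n : ℕ}

/-- The monomial `X^α`. -/
noncomputable def mon (α : Fin n → ℕ) : MvPolynomial (Fin n) ℝ := ∏ i, X i ^ α i

lemma mon_add (α β : Fin n → ℕ) : mon (α + β) = mon α * mon β := by
  simp [mon, pow_add, Finset.prod_mul_distrib]

lemma mon_zero : mon (0 : Fin n → ℕ) = 1 := by simp [mon]

lemma mon_single (i : Fin n) : mon (Pi.single i 1) = X i := by
  rw [mon, Finset.prod_eq_single i]
  · simp
  · intro j _ hj
    simp [hj]
  · simp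

lemma eval_mon (x : Fin n → ℝ) (α : Fin n → ℕ) : eval x (mon α) = ∏ i, x i ^ α i := by
  simp [mon]

lemma mon_nsmul (m : ℕ) (α : Fin n → ℕ) : mon (m • α) = mon α ^ m := by
  induction m with
  | zero => simp [mon_zero]
  | succ k ih => rw [succ_nsmul, mon_add, ih, pow_succ]

lemma le_of_forall_pow_mul_le {b t s C : ℝ} (hb : 0 ≤ b) (ht : 0 ≤ t) (hs : 0 < s)
    (h : ∀ k : ℕ, b ^ (2 ^ (k + 1)) * s ≤ C * t ^ (2 ^ (k + 1))) : b ≤ t := by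
  by_contra! hlt
  have hb0 : 0 < b := ht.trans_lt hlt
  have hexp : Tendsto (fun k : ℕ => 2 ^ (k + 1)) atTop atTop :=
    (tendsto_pow_atTop_atTop_of_one_lt (r := 2) (by norm_num)).comp (tendsto_add_atTop_nat 1)
  have hlim : Tendsto (fun k : ℕ => C * (t / b) ^ (2 ^ (k + 1))) atTop (𝓝 (C * 0)) :=
    ((tendsto_pow_atTop_nhds_zero_of_lt_one (div_nonneg ht hb)
      ((div_lt_one hb0).2 hlt)).comp hexp).const_mul C
  have hle : s ≤ C * 0 := ge_of_tendsto' hlim fun k => by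
    rw [div_pow, ← mul_div_assoc, le_div_iff₀ (by positivity), mul_comm]
    exact h k
  linarith

lemma apply_nsmul_le_pow {φ : (Fin n → ℕ) → ℝ} (hφnonneg : ∀ α, 0 ≤ φ α) (hφ0 : φ 0 = 1)
    (hφmul : ∀ α β, φ (α + β) ≤ φ α * φ β) (m : ℕ) (α : Fin n → ℕ) :
    φ (m • α) ≤ φ α ^ m := by
  induction m with
  | zero => simp [hφ0]
  | succ k ih =>
    rw [succ_nsmul, pow_succ]
    exact (hφmul _ _).trans (mul_le_mul_of_nonneg_right ih (hφnonneg α))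

lemma exists_bound_mon_mul {φ : (Fin n → ℕ) → ℝ} (hφnonneg : ∀ α, 0 ≤ φ α)
    (hφmul : ∀ α β, φ (α + β) ≤ φ α * φ β) (q : MvPolynomial (Fin n) ℝ) :
    ∃ B : ℝ, 0 ≤ B ∧ ∀ (L : MvPolynomial (Fin n) ℝ →ₗ[ℝ] ℝ) (Cb : ℝ), 0 ≤ Cb →
      (∀ α, |L (mon α)| ≤ Cb * φ α) → ∀ α, |L (mon α * q)| ≤ Cb * B * φ α := by
  induction q using MvPolynomial.induction_on with
  | C a =>
    refine ⟨|a|, abs_nonneg a, fun L Cb hCb hL α => ?_⟩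
    have : mon α * C a = a • mon α := by rw [smul_eq_C_mul, mul_comm]
    rw [this, map_smul, smul_eq_mul, abs_mul]
    nlinarith [mul_le_mul_of_nonneg_left (hL α) (abs_nonneg a)]
  | add p q hp hq =>
    obtain ⟨B, hB, hp⟩ := hp
    obtain ⟨D, hD, hq⟩ := hq
    refine ⟨B + D, by positivity, fun L Cb hCb hL α => ?_⟩
    rw [mul_add, map_add]
    have := abs_add_le (L (mon α * p)) (L (mon α * q))
    nlinarith [hp L Cb hCb hL α, hq L Cb hCb hL α]
  | mul_X p i hp =>
    obtain ⟨B, hB, hp⟩ := hp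
    refine ⟨B * φ (Pi.single i 1), mul_nonneg hB (hφnonneg _), fun L Cb hCb hL α => ?_⟩
    have : mon α * (p * X i) = mon (α + Pi.single i 1) * p := by
      rw [mon_add, mon_single]; ring
    rw [this]
    have h1 := hp L Cb hCb hL (α + Pi.single i 1)
    have h2 := mul_le_mul_of_nonneg_left (hφmul α (Pi.single i 1)) (mul_nonneg hCb hB)
    nlinarith

/-- The Cauchy–Schwarz inequality for a positive semidefinite functional. -/
lemma sq_apply_mul_le {L : MvPolynomial (Fin n) ℝ →ₗ[ℝ] ℝ} (hpos : ∀ p, 0 ≤ L (p ^ 2))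
    (p q : MvPolynomial (Fin n) ℝ) : L (p * q) ^ 2 ≤ L (p ^ 2) * L (q ^ 2) := by
  have h : ∀ t : ℝ, 0 ≤ L (q ^ 2) * (t * t) + 2 * L (p * q) * t + L (p ^ 2) := fun t => by
    have : (p + t • q) ^ 2 = (t * t) • q ^ 2 + (2 * t) • (p * q) + p ^ 2 := by
      simp only [smul_eq_C_mul, C_mul, map_ofNat]; ring
    have h2 := hpos (p + t • q)
    rw [this, map_add, map_add, map_smul, map_smul, smul_eq_mul, smul_eq_mul] at h2
    linarith
  have := discrim_le_zero h
  rw [discrim] at this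
  nlinarith

section

variable {φ : (Fin n → ℕ) → ℝ} (hφnonneg : ∀ α, 0 ≤ φ α) (hφ0 : φ 0 = 1)
  (hφmul : ∀ α β, φ (α + β) ≤ φ α * φ β)
include hφnonneg hφ0 hφmul

lemma abs_apply_mon_mul_sq_le {L : MvPolynomial (Fin n) ℝ →ₗ[ℝ] ℝ}
    (hpos : ∀ p, 0 ≤ L (p ^ 2)) {Cb : ℝ} (hCb : 0 ≤ Cb) (hL : ∀ α, |L (mon α)| ≤ Cb * φ α)
    (α : Fin n → ℕ) (q : MvPolynomial (Fin n) ℝ) :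
    |L (mon α * q ^ 2)| ≤ L (q ^ 2) * φ α := by
  have hcs : ∀ β : Fin n → ℕ,
      |L (mon β * q ^ 2)| ^ 2 ≤ L (q ^ 2) * |L (mon (2 • β) * q ^ 2)| := fun β => by
    have h := sq_apply_mul_le hpos q (mon β * q)
    rw [show q * (mon β * q) = mon β * q ^ 2 by ring,
      show (mon β * q) ^ 2 = mon (2 • β) * q ^ 2 by rw [mon_nsmul]; ring] at h
    rw [sq_abs]
    exact h.trans (mul_le_mul_of_nonneg_left (le_abs_self _) (hpos q))
  rcases (hpos q).eq_or_lt with hs | hs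
  · have h := hcs α
    rw [← hs, zero_mul] at h ⊢
    exact (pow_eq_zero_iff two_ne_zero).1 (le_antisymm h (sq_nonneg _)) |>.le
  obtain ⟨B, hB, hbd⟩ := exists_bound_mon_mul hφnonneg hφmul (q ^ 2)
  have hiter : ∀ k : ℕ, |L (mon α * q ^ 2)| ^ 2 ^ k * L (q ^ 2) ≤
      L (q ^ 2) ^ 2 ^ k * |L (mon (2 ^ k • α) * q ^ 2)| := fun k => by
    induction k with
    | zero => simp [mul_comm]
    | succ k ih =>
      have h1 := pow_le_pow_left₀ (by positivity) ih 2
      have h2 := mul_le_mul_of_nonneg_left (hcs (2 ^ k • α))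
        (pow_nonneg hs.le (2 ^ k * 2))
      rw [smul_smul, ← pow_succ'] at h2
      refine le_of_mul_le_mul_right ?_ hs
      rw [mul_pow, mul_pow, ← pow_mul, ← pow_mul] at h1
      rw [pow_succ 2 k] at h2 ⊢
      nlinarith
  refine le_of_forall_pow_mul_le (C := Cb * B) (abs_nonneg _)
    (mul_nonneg hs.le (hφnonneg α)) hs fun k => ?_
  refine (hiter (k + 1)).trans ?_
  rw [mul_pow, mul_left_comm]
  refine mul_le_mul_of_nonneg_left ((hbd L Cb hCb hL _).trans ?_) (by positivity)
  exact mul_le_mul_of_nonneg_left (apply_nsmul_le_pow hφnonneg hφ0 hφmul _ _) (by positivity)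

end

/-- The normalized positive semidefinite functionals dominated by `φ` on monomials. -/
def states (φ : (Fin n → ℕ) → ℝ) : Set (MvPolynomial (Fin n) ℝ → ℝ) :=
  {f | (∀ p q, f (p + q) = f p + f q) ∧ (∀ (c : ℝ) p, f (c • p) = c * f p) ∧ f 1 = 1 ∧
    (∀ p, 0 ≤ f (p ^ 2)) ∧ ∀ α, |f (mon α)| ≤ φ α}

lemma exists_linearMap_of_mem_states {φ : (Fin n → ℕ) → ℝ} {f : MvPolynomial (Fin n) ℝ → ℝ}
    (hf : f ∈ states φ) : ∃ L : MvPolynomial (Fin n) ℝ →ₗ[ℝ] ℝ, ⇑L = f :=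
  ⟨{ toFun := f, map_add' := hf.1, map_smul' := hf.2.1 }, rfl⟩

lemma isClosed_states (φ : (Fin n → ℕ) → ℝ) : IsClosed (states φ) := by
  simp only [states, Set.ofPred_and, Set.ofPred_forall]
  refine (isClosed_iInter fun p => isClosed_iInter fun q => ?_).inter
    ((isClosed_iInter fun p => isClosed_iInter fun q => ?_).inter
    (IsClosed.inter ?_ ((isClosed_iInter fun p => ?_).inter (isClosed_iInter fun p => ?_))))
  · exact isClosed_eq (by fun_prop) (by fun_prop)
  · exact isClosed_eq (by fun_prop) (by fun_prop)
  · exact isClosed_eq (by fun_prop) (by fun_prop)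
  · exact isClosed_le (by fun_prop) (by fun_prop)
  · exact isClosed_le (by fun_prop) (by fun_prop)

lemma convex_states (φ : (Fin n → ℕ) → ℝ) : Convex ℝ (states φ) := by
  rintro f ⟨hf1, hf2, hf3, hf4, hf5⟩ g ⟨hg1, hg2, hg3, hg4, hg5⟩ a b ha hb hab
  refine ⟨fun p q => ?_, fun c p => ?_, ?_, fun p => ?_, fun α => ?_⟩ <;>
    simp only [Pi.add_apply, Pi.smul_apply, smul_eq_mul]
  · rw [hf1, hg1]; ring
  · rw [hf2, hg2]; ring
  · rw [hf3, hg3]; linarith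
  · exact add_nonneg (mul_nonneg ha (hf4 p)) (mul_nonneg hb (hg4 p))
  · have h1 := mul_le_mul_of_nonneg_left (hf5 α) ha
    have h2 := mul_le_mul_of_nonneg_left (hg5 α) hb
    have h3 := abs_add_le (a * f (mon α)) (b * g (mon α))
    rw [abs_mul, abs_mul, abs_of_nonneg ha, abs_of_nonneg hb] at h3
    calc _ ≤ a * φ α + b * φ α := by linarith
      _ = φ α := by rw [← add_mul, hab, one_mul]

section

variable {φ : (Fin n → ℕ) → ℝ} (hφnonneg : ∀ α, 0 ≤ φ α) (hφ0 : φ 0 = 1)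
  (hφmul : ∀ α β, φ (α + β) ≤ φ α * φ β)
include hφnonneg hφ0 hφmul

lemma isCompact_states : IsCompact (states φ) := by
  choose B _ hB using exists_bound_mon_mul hφnonneg hφmul
  refine (isCompact_univ_pi fun p => isCompact_Icc (a := -B p) (b := B p)).of_isClosed_subset
    (isClosed_states φ) fun f hf p _ => ?_
  obtain ⟨L, rfl⟩ := exists_linearMap_of_mem_states hf
  have h := hB p L 1 zero_le_one (by simpa using hf.2.2.2.2) 0
  rw [mon_zero, one_mul, one_mul, hφ0, mul_one] at h
  exact abs_le.1 h

lemma inv_mul_mem_states {L : MvPolynomial (Fin n) ℝ →ₗ[ℝ] ℝ}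
    (hpos : ∀ p, 0 ≤ L (p ^ 2)) {Cb : ℝ} (hCb : 0 ≤ Cb) (hL : ∀ α, |L (mon α)| ≤ Cb * φ α)
    (h1 : 0 < L 1) : (fun p => (L 1)⁻¹ * L p) ∈ states φ := by
  refine ⟨fun p q => ?_, fun c p => ?_, inv_mul_cancel₀ h1.ne', fun p => ?_, fun α => ?_⟩
  · simp only [map_add]; ring
  · simp only [map_smul, smul_eq_mul]; ring
  · exact mul_nonneg (inv_nonneg.2 h1.le) (hpos p)
  · have h := abs_apply_mon_mul_sq_le hφnonneg hφ0 hφmul hpos hCb hL α 1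
    rw [one_pow, mul_one] at h
    rwa [abs_mul, abs_of_pos (inv_pos.2 h1), inv_mul_le_iff₀ h1]

lemma exists_eq_eval_of_mem_extremePoints {f : MvPolynomial (Fin n) ℝ → ℝ}
    (hf : f ∈ (states φ).extremePoints ℝ) : ∃ x : Fin n → ℝ, ∀ p, f p = eval x p := by
  obtain ⟨hfS, hext⟩ := mem_extremePoints_iff_left.1 hf
  obtain ⟨L, rfl⟩ := exists_linearMap_of_mem_states hfS
  obtain ⟨-, -, hL1, hLpos, hLφ⟩ := hfS
  have hLφ' : ∀ α, |L (mon α)| ≤ 1 * φ α := by simpa using hLφ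
  have hmul : ∀ i p, L (X i * p) = L (X i) * L p := by
    intro i
    set R : ℝ := φ (Pi.single i 1) + 1 with hR
    have hR0 : 0 < R := by have := hφnonneg (Pi.single i 1); linarith
    let G : ℝ → MvPolynomial (Fin n) ℝ →ₗ[ℝ] ℝ := fun σ =>
      L.comp (LinearMap.mulRight ℝ (C R + C σ * X i))
    have hG : ∀ σ p, G σ p = R * L p + σ * L (X i * p) := fun σ p => by
      have : p * (C R + C σ * X i) = R • p + σ • (X i * p) := by
        simp only [smul_eq_C_mul]; ring
      simp only [G, LinearMap.comp_apply, LinearMap.mulRight_apply, this, map_add, map_smul,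
        smul_eq_mul]
    have hX : ∀ p, |L (X i * p ^ 2)| ≤ L (p ^ 2) * φ (Pi.single i 1) := fun p => by
      have := abs_apply_mon_mul_sq_le hφnonneg hφ0 hφmul hLpos zero_le_one hLφ'
        (Pi.single i 1) p
      rwa [mon_single] at this
    have hsign : ∀ σ : ℝ, |σ| = 1 → ∀ p, L (p ^ 2) ≤ G σ (p ^ 2) := fun σ hσ p => by
      have h1 : |σ * L (X i * p ^ 2)| ≤ L (p ^ 2) * φ (Pi.single i 1) := by
        rw [abs_mul, hσ, one_mul]; exact hX p
      have h2 := (abs_le.1 h1).1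
      rw [hG, hR]
      linarith
    have hG1 : ∀ σ : ℝ, |σ| = 1 → 0 < G σ 1 := fun σ hσ => by
      have := hsign σ hσ 1
      rw [one_pow, hL1] at this
      linarith
    have hmem : ∀ σ : ℝ, |σ| = 1 → (fun p => (G σ 1)⁻¹ * G σ p) ∈ states φ := fun σ hσ => by
      obtain ⟨B, hB, hbd⟩ := exists_bound_mon_mul hφnonneg hφmul (C R + C σ * X i)
      exact inv_mul_mem_states hφnonneg hφ0 hφmul
        (fun p => (hLpos p).trans (hsign σ hσ p)) (mul_nonneg zero_le_one hB)
        (fun α => hbd L 1 zero_le_one hLφ' α) (hG1 σ hσ)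
    have hp := hG1 1 (by simp)
    have hm := hG1 (-1) (by simp)
    have hsum : G 1 1 + G (-1) 1 = 2 * R := by rw [hG, hG, hL1]; ring
    have hseg : ⇑L ∈ openSegment ℝ (fun p => (G 1 1)⁻¹ * G 1 p)
        (fun p => (G (-1) 1)⁻¹ * G (-1) p) := by
      refine ⟨G 1 1 / (2 * R), G (-1) 1 / (2 * R), by positivity, by positivity, ?_, ?_⟩
      · rw [← add_div, hsum, div_self (by positivity)]
      · funext p
        have h2 : G 1 p + G (-1) p = 2 * R * L p := by rw [hG, hG]; ring
        simp only [Pi.add_apply, Pi.smul_apply, smul_eq_mul]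
        field_simp
        linarith
    have heq := hext _ (hmem 1 (by simp)) _ (hmem (-1) (by simp)) hseg
    intro p
    have hpt := congrFun heq p
    rw [inv_mul_eq_iff_eq_mul₀ hp.ne', hG, hG, hL1, mul_one, mul_one] at hpt
    linarith
  refine ⟨fun i => L (X i), fun p => ?_⟩
  induction p using MvPolynomial.induction_on with
  | C a =>
    rw [eval_C, ← mul_one (C a), ← smul_eq_C_mul, map_smul, hL1, smul_eq_mul, mul_one]
  | add p q hp hq => rw [map_add, map_add, hp, hq]
  | mul_X p i hp => rw [mul_comm, hmul, hp, map_mul, eval_X]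

end

/-- The points whose monomial evaluations are dominated by `φ`. -/
def dominated (φ : (Fin n → ℕ) → ℝ) : Set (Fin n → ℝ) := {x | ∀ α, |eval x (mon α)| ≤ φ α}

lemma continuous_eval_left (p : MvPolynomial (Fin n) ℝ) :
    Continuous fun x : Fin n → ℝ => eval x p :=
  MvPolynomial.continuous_eval p

lemma isCompact_dominated (φ : (Fin n → ℕ) → ℝ) : IsCompact (dominated φ) := by
  refine (isCompact_univ_pi fun i => isCompact_Icc (a := -φ (Pi.single i 1))
    (b := φ (Pi.single i 1))).of_isClosed_subset ?_ fun x hx i _ => ?_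
  · simp only [dominated, Set.ofPred_forall]
    exact isClosed_iInter fun α => isClosed_le (continuous_eval_left _).abs continuous_const
  · have := hx (Pi.single i 1)
    rw [mon_single, eval_X] at this
    exact abs_le.1 this

lemma integrable_eval_of_dominated {φ : (Fin n → ℕ) → ℝ} (P : Measure (dominated φ))
    [IsFiniteMeasure P] (p : MvPolynomial (Fin n) ℝ) :
    Integrable (fun x : dominated φ => eval (x : Fin n → ℝ) p) P := by
  have := isCompact_iff_compactSpace.1 (isCompact_dominated φ)
  exact (((continuous_eval_left p).comp continuous_subtype_val).integrable_of_hasCompactSupport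
    (HasCompactSupport.of_compactSpace _))

/-- The moment functional of a probability measure on `dominated φ`. -/
noncomputable def moments (φ : (Fin n → ℕ) → ℝ) (P : ProbabilityMeasure (dominated φ)) :
    MvPolynomial (Fin n) ℝ → ℝ :=
  fun p => ∫ x, eval (x : Fin n → ℝ) p ∂(P : Measure (dominated φ))

lemma continuous_moments (φ : (Fin n → ℕ) → ℝ) : Continuous (moments φ) := by
  have := isCompact_iff_compactSpace.1 (isCompact_dominated φ)
  refine continuous_pi fun p => ?_
  exact ProbabilityMeasure.continuous_integral_boundedContinuousFunction
    (BoundedContinuousFunction.mkOfCompact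
      ⟨fun x : dominated φ => eval (x : Fin n → ℝ) p,
        (continuous_eval_left p).comp continuous_subtype_val⟩)

lemma convex_range_moments (φ : (Fin n → ℕ) → ℝ) : Convex ℝ (Set.range (moments φ)) := by
  rintro _ ⟨P, rfl⟩ _ ⟨Q, rfl⟩ a b ha hb hab
  let M : Measure (dominated φ) :=
    ENNReal.ofReal a • (P : Measure (dominated φ)) + ENNReal.ofReal b • (Q : Measure _)
  have hM : IsProbabilityMeasure M := ⟨by
    simp [M, ← ENNReal.ofReal_add ha hb, hab]⟩
  refine ⟨⟨M, hM⟩, funext fun p => ?_⟩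
  simp only [moments, Pi.add_apply, Pi.smul_apply, smul_eq_mul, ProbabilityMeasure.coe_mk, M]
  rw [integral_add_measure, integral_smul_measure, integral_smul_measure,
    ENNReal.toReal_ofReal ha, ENNReal.toReal_ofReal hb, smul_eq_mul, smul_eq_mul]
  · exact (integrable_eval_of_dominated _ p).smul_measure ENNReal.ofReal_ne_top
  · exact (integrable_eval_of_dominated _ p).smul_measure ENNReal.ofReal_ne_top

lemma states_subset_range_moments {φ : (Fin n → ℕ) → ℝ} (hφnonneg : ∀ α, 0 ≤ φ α)
    (hφ0 : φ 0 = 1) (hφmul : ∀ α β, φ (α + β) ≤ φ α * φ β) :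
    states φ ⊆ Set.range (moments φ) := by
  have := isCompact_iff_compactSpace.1 (isCompact_dominated φ)
  rw [← closure_convexHull_extremePoints (isCompact_states hφnonneg hφ0 hφmul)
    (convex_states φ)]
  refine closure_minimal (convexHull_min (fun f hf => ?_) (convex_range_moments φ))
    (isCompact_range (continuous_moments φ)).isClosed
  obtain ⟨x, hx⟩ := exists_eq_eval_of_mem_extremePoints hφnonneg hφ0 hφmul hf
  have hxK : x ∈ dominated φ := fun α => by
    rw [← hx]
    exact hf.1.2.2.2.2 α
  refine ⟨⟨Measure.dirac ⟨x, hxK⟩, inferInstance⟩, funext fun p => ?_⟩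
  simp only [moments, ProbabilityMeasure.coe_mk, integral_dirac, hx]

/-- `μ` represents the functional `L`. -/
def Represents (L : MvPolynomial (Fin n) ℝ →ₗ[ℝ] ℝ) (μ : Measure (Fin n → ℝ)) : Prop :=
  (∀ p, Integrable (fun x => eval x p) μ) ∧ ∀ p, L p = ∫ x, eval x p ∂μ

lemma Represents.isFiniteMeasure {L : MvPolynomial (Fin n) ℝ →ₗ[ℝ] ℝ}
    {μ : Measure (Fin n → ℝ)} (hμ : Represents L μ) : IsFiniteMeasure μ := by
  have h := hμ.1 1
  simp only [map_one] at h
  exact (integrable_const_iff_isFiniteMeasure one_ne_zero).1 h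

section

variable {φ : (Fin n → ℕ) → ℝ} (hφnonneg : ∀ α, 0 ≤ φ α) (hφ0 : φ 0 = 1)
  (hφmul : ∀ α β, φ (α + β) ≤ φ α * φ β) {L : MvPolynomial (Fin n) ℝ →ₗ[ℝ] ℝ} {Cb : ℝ}
  (hCb : 0 ≤ Cb) (hL : ∀ α, |L (mon α)| ≤ Cb * φ α)
include hφnonneg hφ0 hφmul hCb hL

lemma exists_represents (hpos : ∀ p, 0 ≤ L (p ^ 2)) : ∃ μ, Represents L μ := by
  have h1 : 0 ≤ L 1 := by simpa using hpos 1
  rcases h1.eq_or_lt with h1 | h1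
  · refine ⟨0, fun p => integrable_zero_measure, fun p => ?_⟩
    rw [integral_zero_measure]
    have h := sq_apply_mul_le hpos 1 p
    rw [one_pow, ← h1, zero_mul, one_mul] at h
    exact (pow_eq_zero_iff two_ne_zero).1 (le_antisymm h (sq_nonneg _))
  obtain ⟨P, hP⟩ := states_subset_range_moments hφnonneg hφ0 hφmul
    (inv_mul_mem_states hφnonneg hφ0 hφmul hpos hCb hL h1)
  have hemb : MeasurableEmbedding (Subtype.val : dominated φ → Fin n → ℝ) :=
    MeasurableEmbedding.subtype_coe (isCompact_dominated φ).isClosed.measurableSet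
  refine ⟨ENNReal.ofReal (L 1) • (P : Measure (dominated φ)).map Subtype.val,
    fun p => ?_, fun p => ?_⟩
  · refine Integrable.smul_measure ?_ ENNReal.ofReal_ne_top
    exact hemb.integrable_map_iff.2 (integrable_eval_of_dominated _ p)
  · rw [integral_smul_measure, hemb.integral_map, ENNReal.toReal_ofReal h1.le, smul_eq_mul]
    have := congrFun hP p
    simp only [moments] at this
    rw [this, mul_inv_cancel_left₀ h1.ne']

lemma Represents.ae_mem_dominated {μ : Measure (Fin n → ℝ)} (hμ : Represents L μ) :
    ∀ᵐ x ∂μ, x ∈ dominated φ := by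
  have := hμ.isFiniteMeasure
  refine ae_all_iff.2 fun α => ?_
  have hlevel : ∀ r, φ α < r → μ {x | r ≤ |eval x (mon α)|} = 0 := by
    intro r hr
    have hr0 : 0 ≤ r := (hφnonneg α).trans hr.le
    by_contra hne
    have hs : 0 < μ.real {x | r ≤ |eval x (mon α)|} :=
      ENNReal.toReal_pos hne (measure_ne_top _ _)
    refine hr.not_ge (le_of_forall_pow_mul_le (C := Cb) hr0 (hφnonneg α) hs fun k => ?_)
    have heven : Even (2 ^ (k + 1)) := ⟨2 ^ k, by ring⟩
    have hfun : (fun x : Fin n → ℝ => eval x (mon (2 ^ (k + 1) • α))) =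
        fun x => |eval x (mon α)| ^ 2 ^ (k + 1) := by
      funext x
      rw [mon_nsmul, map_pow, heven.pow_abs]
    have hint := hμ.1 (mon (2 ^ (k + 1) • α))
    have hval := hμ.2 (mon (2 ^ (k + 1) • α))
    rw [hfun] at hint hval
    have hmarkov := mul_meas_ge_le_integral_of_nonneg
      (ae_of_all μ fun x => by positivity) hint (r ^ 2 ^ (k + 1))
    have hset : {x : Fin n → ℝ | r ^ 2 ^ (k + 1) ≤ |eval x (mon α)| ^ 2 ^ (k + 1)} =
        {x | r ≤ |eval x (mon α)|} := by
      ext x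
      exact pow_le_pow_iff_left₀ hr0 (abs_nonneg _) (by positivity)
    rw [hset, ← hval] at hmarkov
    calc _ ≤ _ := hmarkov
      _ ≤ _ := (le_abs_self _).trans (hL _)
      _ ≤ _ := mul_le_mul_of_nonneg_left (apply_nsmul_le_pow hφnonneg hφ0 hφmul _ _) hCb
  have hall : ∀ m : ℕ, ∀ᵐ x ∂μ, |eval x (mon α)| < φ α + 1 / ((m : ℝ) + 1) := fun m => by
    rw [ae_iff]
    simp only [not_lt]
    exact hlevel _ (lt_add_of_pos_right _ (by positivity))
  filter_upwards [ae_all_iff.2 hall] with x hx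
  have hlim := (tendsto_one_div_add_atTop_nhds_zero_nat (𝕜 := ℝ)).const_add (φ α)
  rw [add_zero] at hlim
  exact ge_of_tendsto' hlim fun m => (hx m).le

lemma Represents.unique {μ ν : Measure (Fin n → ℝ)} (hμ : Represents L μ)
    (hν : Represents L ν) : μ = ν := by
  have := hμ.isFiniteMeasure
  have := hν.isFiniteMeasure
  refine ext_of_forall_integral_eq_of_IsFiniteMeasure fun f => ?_
  let ev : MvPolynomial (Fin n) ℝ →ₐ[ℝ] C(Fin n → ℝ, ℝ) :=
    aeval fun i => ⟨fun x => x i, continuous_apply i⟩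
  have hev : ∀ p x, ev p x = eval x p := fun p x => by
    induction p using MvPolynomial.induction_on with
    | C a => simp [ev]
    | add p q hp hq => simp [hp, hq]
    | mul_X p i hp =>
      rw [map_mul, map_mul, ContinuousMap.mul_apply, hp, eval_X]
      simp [ev]
  have hsep : ev.range.SeparatesPoints := fun x y hxy => by
    obtain ⟨i, hi⟩ := Function.ne_iff.1 hxy
    exact ⟨_, ⟨ev (X i), ⟨X i, rfl⟩, rfl⟩, by simpa [hev] using hi⟩
  have hclose : ∀ {ρ : Measure (Fin n → ℝ)}, Represents L ρ → ∀ p ε,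
      (∀ x ∈ dominated φ, ‖eval x p - f x‖ < ε) → |L p - ∫ x, f x ∂ρ| ≤ ε * L 1 := by
    intro ρ hρ p ε hp
    have : IsFiniteMeasure ρ := hρ.isFiniteMeasure
    rw [hρ.2 p, ← integral_sub (hρ.1 p) (f.integrable ρ), hρ.2 1]
    simp only [map_one, integral_const, smul_eq_mul, mul_one]
    rw [← Real.norm_eq_abs]
    refine norm_integral_le_of_norm_le_const (μ := ρ) ?_
    filter_upwards [hρ.ae_mem_dominated hφnonneg hφ0 hφmul hCb hL] with x hx
    exact (hp x hx).le
  have hdiff : ∀ ε : ℝ, 0 < ε → |∫ x, f x ∂μ - ∫ x, f x ∂ν| ≤ ε * (2 * L 1) := by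
    intro ε hε
    obtain ⟨g, ⟨p, rfl⟩, hp⟩ :=
      ContinuousMap.exists_mem_subalgebra_near_continuous_of_isCompact_of_separatesPoints hsep
        (f : C(Fin n → ℝ, ℝ)) (isCompact_dominated φ) hε
    have hp' : ∀ x ∈ dominated φ, ‖eval x p - f x‖ < ε := fun x hx => by
      rw [← hev]; exact hp x hx
    have h1 := abs_le.1 (hclose hμ p ε hp')
    have h2 := abs_le.1 (hclose hν p ε hp')
    exact abs_le.2 ⟨by linarith [h1.2, h2.1], by linarith [h1.1, h2.2]⟩
  have hlim : Tendsto (fun ε : ℝ => ε * (2 * L 1)) (𝓝[>] 0) (𝓝 (0 * (2 * L 1))) :=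
    (tendsto_nhdsWithin_of_tendsto_nhds tendsto_id).mul_const _
  have hle := ge_of_tendsto hlim (eventually_mem_nhdsWithin.mono fun ε hε => hdiff ε hε)
  rw [zero_mul] at hle
  exact sub_eq_zero.1 (abs_nonpos_iff.1 hle)

end

end MomentProblem

open MvPolynomial MeasureTheory

/-- Berg–Christensen–Ressel: if `L(p²) ≥ 0` for all `p` and `|L(X^α)| ≤ C φ(α)` for an
absolute value `φ`, then `L` has exactly one representing measure `μ` on `ℝⁿ`, and the
support of every representing measure is contained in
`{x : |x^α| ≤ φ(α) for all α}`. -/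
theorem stmt_19 (n : ℕ) (L : MvPolynomial (Fin n) ℝ →ₗ[ℝ] ℝ)
    (hpos : ∀ p : MvPolynomial (Fin n) ℝ, 0 ≤ L (p ^ 2))
    (φ : (Fin n → ℕ) → ℝ) (hφnonneg : ∀ α, 0 ≤ φ α) (hφ0 : φ 0 = 1)
    (hφmul : ∀ α β : Fin n → ℕ, φ (α + β) ≤ φ α * φ β)
    (Cb : ℝ) (hCb : 0 < Cb)
    (hbound : ∀ α : Fin n → ℕ, |L (∏ i, X i ^ α i)| ≤ Cb * φ α) :
    (∃! μ : Measure (Fin n → ℝ),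
        (∀ p : MvPolynomial (Fin n) ℝ, Integrable (fun x => eval x p) μ) ∧
        (∀ p : MvPolynomial (Fin n) ℝ, L p = ∫ x, eval x p ∂μ)) ∧
      ∀ μ : Measure (Fin n → ℝ),
        ((∀ p : MvPolynomial (Fin n) ℝ, Integrable (fun x => eval x p) μ) ∧
         (∀ p : MvPolynomial (Fin n) ℝ, L p = ∫ x, eval x p ∂μ)) →
        μ {x : Fin n → ℝ | ¬ ∀ α : Fin n → ℕ, |∏ i, (x i) ^ (α i)| ≤ φ α} = 0 := by
  have hae : ∀ μ, MomentProblem.Represents L μ → ∀ᵐ x ∂μ, x ∈ MomentProblem.dominated φ :=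
    fun μ hμ => hμ.ae_mem_dominated hφnonneg hφ0 hφmul hCb.le hbound
  constructor
  · obtain ⟨μ, hμ⟩ :=
      MomentProblem.exists_represents hφnonneg hφ0 hφmul hCb.le hbound hpos
    exact ⟨μ, hμ, fun ν hν =>
      MomentProblem.Represents.unique hφnonneg hφ0 hφmul hCb.le hbound hν hμ⟩
  · intro μ hμ
    have h := ae_iff.1 (hae μ hμ)
    simpa only [MomentProblem.dominated, Set.mem_ofPred_eq, MomentProblem.eval_mon] using h
end
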